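/- For every integer n ≥ 2, let f : QuaternionGroup n → DihedralGroup n be the map defined by f(a i) = r (i mod n) and f(xa i) = sr (i mod n), where i mod n denotes the reduction ZMod (2n) → ZMod n. Then for all g, h ∈ QuaternionGroup n, the subgroup generated by {g,h} equals all of QuaternionGroup n if and only if the subgroup generated by {f g, f h} equals all of DihedralGroup n. (This expresses that the quotient of Γ(Q_n) by the partition into pairs {x^i, x^{n+i}}, {x^i y, x^{n+i} y} is isomorphic to Γ(D_n).) -/

import Mathlib

/-- The natural map `Q_n → D_n` sending `x^i ↦ r^(i mod n)` and `x^i y ↦ s r^(i mod n)`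
(reduction of the quotient by the centre). -/
def quotMap (n : ℕ) : QuaternionGroup n → DihedralGroup n
  | QuaternionGroup.a i => DihedralGroup.r (ZMod.castHom (dvd_mul_left n 2) (ZMod n) i)
  | QuaternionGroup.xa i => DihedralGroup.sr (ZMod.castHom (dvd_mul_left n 2) (ZMod n) i)

/-- `quotMap n` as a group homomorphism. -/
def quotHom (n : ℕ) : QuaternionGroup n →* DihedralGroup n :=
  MonoidHom.mk' (quotMap n) (by
    rintro (i | i) (j | j) <;> simp only [quotMap, QuaternionGroup.a_mul_a,
      QuaternionGroup.a_mul_xa, QuaternionGroup.xa_mul_a, QuaternionGroup.xa_mul_xa,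
      DihedralGroup.r_mul_r, DihedralGroup.r_mul_sr, DihedralGroup.sr_mul_r,
      DihedralGroup.sr_mul_sr, map_add, map_sub, map_natCast, CharP.cast_eq_zero, zero_add])

theorem quotHom_apply (n : ℕ) (g : QuaternionGroup n) : quotHom n g = quotMap n g := rfl

theorem quotHom_surjective (n : ℕ) : Function.Surjective (quotHom n) := by
  have hsurj := ZMod.castHom_surjective (dvd_mul_left n 2)
  rintro (j | j) <;> obtain ⟨i, rfl⟩ := hsurj j
  · exact ⟨QuaternionGroup.a i, rfl⟩
  · exact ⟨QuaternionGroup.xa i, rfl⟩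

theorem eq_zero_or_eq_of_castHom_eq_zero {n : ℕ} {i : ZMod (2 * n)}
    (hi : ZMod.castHom (dvd_mul_left n 2) (ZMod n) i = 0) : i = 0 ∨ i = n := by
  obtain ⟨k, rfl⟩ := ZMod.intCast_surjective i
  rw [map_intCast, ZMod.intCast_zmod_eq_zero_iff_dvd] at hi
  obtain ⟨m, rfl⟩ := hi
  have h2n : (2 * n : ZMod (2 * n)) = 0 := by exact_mod_cast ZMod.natCast_self (2 * n)
  obtain ⟨t, rfl | rfl⟩ := Int.even_or_odd' m
  · left
    push_cast
    linear_combination (t : ZMod (2 * n)) * h2n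
  · right
    push_cast
    linear_combination (t : ZMod (2 * n)) * h2n

theorem mem_ker_quotHom {n : ℕ} {g : QuaternionGroup n} (hg : g ∈ (quotHom n).ker) :
    g = 1 ∨ g = QuaternionGroup.a n := by
  rw [MonoidHom.mem_ker, quotHom_apply, DihedralGroup.one_def] at hg
  rcases g with i | i
  · rcases eq_zero_or_eq_of_castHom_eq_zero (DihedralGroup.r.inj hg) with rfl | rfl
    · exact Or.inl rfl
    · exact Or.inr rfl
  · cases hg

/-- A subgroup of `Q_n` mapping onto `D_n` contains some `x^i y`, hence its square, which generates
the kernel; so `quotHom n` is a Frattini quotient. -/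
theorem map_quotHom_eq_top_iff {n : ℕ} (K : Subgroup (QuaternionGroup n)) :
    K.map (quotHom n) = ⊤ ↔ K = ⊤ := by
  refine ⟨fun hK => ?_, ?_⟩
  · have hker : (quotHom n).ker ≤ K := by
      intro g hg
      rcases mem_ker_quotHom hg with rfl | rfl
      · exact K.one_mem
      · obtain ⟨i | i, hi, hmap⟩ : DihedralGroup.sr 0 ∈ K.map (quotHom n) :=
          hK ▸ Subgroup.mem_top _
        · cases hmap
        · exact QuaternionGroup.xa_sq i ▸ K.pow_mem hi 2
    rw [← Subgroup.comap_map_eq_self hker, hK, Subgroup.comap_top]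
  · rintro rfl
    exact Subgroup.map_top_of_surjective _ (quotHom_surjective n)

/-- For `n ≥ 2`, two elements generate `Q_n` iff their images under `quotMap` generate `D_n`;
i.e. the quotient of `Γ(Q_n)` by the partition into pairs `{x^i, x^{n+i}}`, `{x^i y, x^{n+i} y}`
is isomorphic to `Γ(D_n)`. -/
theorem dicyclic_gen_iff_dihedral_gen (n : ℕ) (hn : 2 ≤ n) (g h : QuaternionGroup n) :
    Subgroup.closure ({g, h} : Set (QuaternionGroup n)) = ⊤ ↔
      Subgroup.closure ({quotMap n g, quotMap n h} : Set (DihedralGroup n)) = ⊤ := by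
  rw [← map_quotHom_eq_top_iff, MonoidHom.map_closure, Set.image_pair]
  rfl
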